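/- arXiv:2605.00612 — 3 statements merged into one kernel-verified Lean document; each statement's English description precedes it below -/
import Mathlib

section
/- Let Z be a real N×T matrix and let R be a natural number with R ≤ N and R ≤ T. Then the infimum over all real N×R matrices λ and all real T×R matrices f of Tr[(Z − λfᵀ)(Z − λfᵀ)ᵀ] = ‖Z − λfᵀ‖_F² equals Σ_{i=R+1}^{T} μ_i(ZᵀZ), the sum of the T − R smallest eigenvalues of ZᵀZ, and this infimum is attained by some pair (λ, f). -/
open Matrix

/-- `mu A i` is the `i`-th largest eigenvalue (counted with multiplicity, `i : Fin n`
indexed from `0`) of a real symmetric matrix `A` (junk value `0` if `A` is not symmetric). -/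
noncomputable def mu {n : ℕ} (A : Matrix (Fin n) (Fin n) ℝ) (i : Fin n) : ℝ :=
  if hA : A.IsHermitian then hA.eigenvalues ((Tuple.sort hA.eigenvalues) i.rev) else 0

namespace Matrix

variable {m n : Type*} [Fintype m] [Fintype n]

theorem trace_mul_transpose_self_nonneg (B : Matrix m n ℝ) : 0 ≤ trace (B * Bᵀ) := by
  simpa using (posSemidef_self_mul_conjTranspose B).trace_nonneg

/-- For an orthogonal projection `Q`, `Tr (BQ(BQ)ᵀ) = Tr (BᵀBQ)`. -/
theorem trace_mul_projection_mul_transpose (B : Matrix m n ℝ) {Q : Matrix n n ℝ}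
    (hQt : Qᵀ = Q) (hQ : Q * Q = Q) :
    trace ((B * Q) * (B * Q)ᵀ) = trace (Bᵀ * B * Q) := by
  rw [transpose_mul, hQt, Matrix.mul_assoc, ← Matrix.mul_assoc Q, hQ, trace_mul_comm,
    Matrix.mul_assoc, trace_mul_comm]

theorem diag_conj_projection_nonneg {p : Type*} (V : Matrix n p ℝ) {Q : Matrix n n ℝ}
    (hQt : Qᵀ = Q) (hQ : Q * Q = Q) (j : p) : 0 ≤ (Vᵀ * Q * V) j j := by
  have h : Vᵀ * Q * V = (Q * V)ᵀ * (Q * V) := by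
    rw [transpose_mul, hQt, Matrix.mul_assoc Vᵀ Q (Q * V), ← Matrix.mul_assoc Q, hQ,
      Matrix.mul_assoc]
  rw [h, mul_apply]
  exact Finset.sum_nonneg fun i _ => mul_self_nonneg _

theorem projection_compl [DecidableEq n] {P : Matrix n n ℝ} (hPt : Pᵀ = P) (hP : P * P = P) :
    (1 - P)ᵀ = 1 - P ∧ (1 - P) * (1 - P) = 1 - P := by
  refine ⟨by rw [transpose_sub, hPt, transpose_one], ?_⟩
  simp [Matrix.sub_mul, Matrix.mul_sub, hP]

/-- The orthogonal projection onto the column space of a matrix with `r` columns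
has trace at most `r`. -/
theorem exists_column_projection [DecidableEq n] (f : Matrix n m ℝ) :
    ∃ P : Matrix n n ℝ, Pᵀ = P ∧ P * P = P ∧ fᵀ * (1 - P) = 0 ∧
      trace P ≤ Fintype.card m := by
  have hA : (f * fᵀ).IsHermitian := by simpa using isHermitian_mul_conjTranspose_self f
  set U : Matrix n n ℝ := hA.eigenvectorUnitary.val
  have hU : Uᵀ * U = 1 := by
    simpa [star_eq_conjTranspose] using Unitary.coe_star_mul_self hA.eigenvectorUnitary
  have hU' : U * Uᵀ = 1 := mul_eq_one_comm.mp hU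
  have hspec : f * fᵀ = U * diagonal hA.eigenvalues * Uᵀ := by
    have := hA.spectral_theorem
    simpa [Unitary.conjStarAlgAut_apply, star_eq_conjTranspose, Function.comp_def] using this
  have hmul (a b : n → ℝ) : (U * diagonal a * Uᵀ) * (U * diagonal b * Uᵀ) =
      U * diagonal (fun i => a i * b i) * Uᵀ := by
    rw [← diagonal_mul_diagonal]
    simp only [Matrix.mul_assoc]
    rw [← Matrix.mul_assoc Uᵀ U, hU, Matrix.one_mul]
  set e : n → ℝ := fun i => if hA.eigenvalues i ≠ 0 then 1 else 0 with he
  refine ⟨U * diagonal e * Uᵀ, ?_, ?_, ?_, ?_⟩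
  · simp [Matrix.mul_assoc]
  · rw [hmul]
    congr 3
    ext i
    simp [he]
  · have h0 : f * fᵀ * (1 - U * diagonal e * Uᵀ) = 0 := by
      rw [Matrix.mul_sub, Matrix.mul_one, hspec, hmul, sub_eq_zero]
      congr 3
      ext i
      by_cases h : hA.eigenvalues i = 0 <;> simp [he, h]
    simpa using (self_mul_conjTranspose_mul_eq_zero f _).mp (by simpa using h0)
  · rw [trace_mul_comm, ← Matrix.mul_assoc, hU, Matrix.one_mul, trace_diagonal]
    have hr : (f * fᵀ).rank ≤ Fintype.card m :=
      (rank_mul_le_left _ _).trans (rank_le_card_width f)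
    rw [hA.rank_eq_card_non_zero_eigs, Fintype.card_subtype] at hr
    simpa only [he, Finset.sum_boole, Nat.cast_le] using hr

end Matrix

theorem mu_antitone {n : ℕ} (A : Matrix (Fin n) (Fin n) ℝ) : Antitone (mu A) := by
  intro i j hij
  unfold mu
  split_ifs with hA
  · exact Tuple.monotone_sort hA.eigenvalues (Fin.rev_le_rev.mpr hij)
  · exact le_rfl

theorem mu_nonneg {n : ℕ} {A : Matrix (Fin n) (Fin n) ℝ} (hA : A.PosSemidef) (i : Fin n) :
    0 ≤ mu A i := by
  rw [mu, dif_pos hA.isHermitian]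
  exact hA.eigenvalues_nonneg _

theorem exists_orthogonal_diagonalization_mu {n : ℕ} {A : Matrix (Fin n) (Fin n) ℝ}
    (hA : A.IsHermitian) :
    ∃ V : Matrix (Fin n) (Fin n) ℝ, Vᵀ * V = 1 ∧ A = V * diagonal (mu A) * Vᵀ := by
  let σ : Equiv.Perm (Fin n) := Fin.revPerm.trans (Tuple.sort hA.eigenvalues)
  set U : Matrix (Fin n) (Fin n) ℝ := hA.eigenvectorUnitary.val
  have hU : Uᵀ * U = 1 := by
    simpa [star_eq_conjTranspose] using Unitary.coe_star_mul_self hA.eigenvectorUnitary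
  have hspec : A = U * diagonal hA.eigenvalues * Uᵀ := by
    have := hA.spectral_theorem
    simpa [Unitary.conjStarAlgAut_apply, star_eq_conjTranspose, Function.comp_def] using this
  have hmu : diagonal (mu A) = (diagonal hA.eigenvalues).submatrix σ σ := by
    rw [submatrix_diagonal_equiv]
    congr 1
    ext i
    rw [mu, dif_pos hA]
    rfl
  refine ⟨U.submatrix id σ, ?_, ?_⟩
  · rw [transpose_submatrix, submatrix_mul _ _ _ _ _ Function.bijective_id |>.symm, hU,
      submatrix_one_equiv]
  · rw [hmu, transpose_submatrix, submatrix_mul_equiv, submatrix_mul_equiv, submatrix_id_id,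
      ← hspec]

theorem trace_conj_diagonal_mul {n : Type*} [Fintype n] [DecidableEq n]
    (V Q : Matrix n n ℝ) (d : n → ℝ) :
    trace (V * diagonal d * Vᵀ * Q) = ∑ j, d j * (Vᵀ * Q * V) j j := by
  rw [Matrix.mul_assoc, Matrix.mul_assoc, trace_mul_comm, Matrix.mul_assoc]
  simp [trace, diagonal_mul]

/-- A sum with weights in `[0, 1]` of total at most `R` is at most the sum of the `R` largest
terms; stated for the complementary weights. -/
theorem sum_tail_le_sum_mul_one_sub {n R : ℕ} (hR : R ≤ n) {d p : Fin n → ℝ}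
    (hd : Antitone d) (hd0 : ∀ i, 0 ≤ d i) (hp0 : ∀ i, 0 ≤ p i) (hp1 : ∀ i, p i ≤ 1)
    (hp : ∑ i, p i ≤ R) :
    ∑ i ∈ Finset.univ.filter (fun i : Fin n => R ≤ (i : ℕ)), d i ≤ ∑ i, d i * (1 - p i) := by
  obtain ⟨c, hc0, hlt, hge⟩ : ∃ c : ℝ, 0 ≤ c ∧ (∀ i : Fin n, (i : ℕ) < R → c ≤ d i) ∧
      ∀ i : Fin n, R ≤ (i : ℕ) → d i ≤ c := by
    rcases hR.lt_or_eq with h | h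
    · exact ⟨d ⟨R, h⟩, hd0 _, fun i hi => hd (Fin.le_def.mpr hi.le),
        fun i hi => hd (Fin.le_def.mpr hi)⟩
    · exact ⟨0, le_rfl, fun i _ => hd0 i, fun i hi => absurd i.isLt (by omega)⟩
  have hcard : ∑ i : Fin n, (if R ≤ (i : ℕ) then (0 : ℝ) else 1) = R := by
    have : ∑ i ∈ Finset.range n, (if R ≤ i then (0 : ℝ) else 1) = R := by
      obtain ⟨k, rfl⟩ := Nat.exists_eq_add_of_le hR
      rw [Finset.sum_range_add, Finset.sum_congr rfl
        (fun i hi => if_neg (not_le.mpr (Finset.mem_range.mp hi)))]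
      simp
    rw [← this, Finset.sum_range]
  have hterm (i : Fin n) : (if R ≤ (i : ℕ) then d i else 0) +
      c * ((if R ≤ (i : ℕ) then (0 : ℝ) else 1) - p i) ≤ d i * (1 - p i) := by
    split_ifs with h
    · nlinarith [hge i h, hp0 i]
    · nlinarith [hlt i (not_le.mp h), hp1 i]
  have hsum := Finset.sum_le_sum fun i (_ : i ∈ Finset.univ) => hterm i
  rw [Finset.sum_add_distrib, ← Finset.mul_sum, Finset.sum_sub_distrib, hcard] at hsum
  rw [Finset.sum_filter]
  nlinarith [mul_nonneg hc0 (sub_nonneg.mpr hp)]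

/-- The infimum over all `N×R` matrices `λ` and `T×R` matrices `f` of
`Tr[(Z − λfᵀ)(Z − λfᵀ)ᵀ]` equals the sum of the `T − R` smallest eigenvalues of `ZᵀZ`,
and the infimum is attained. -/
theorem statement0 (N T R : ℕ) (hRN : R ≤ N) (hRT : R ≤ T)
    (Z : Matrix (Fin N) (Fin T) ℝ) :
    IsLeast {x : ℝ | ∃ (l : Matrix (Fin N) (Fin R) ℝ) (f : Matrix (Fin T) (Fin R) ℝ),
        x = Matrix.trace ((Z - l * fᵀ) * (Z - l * fᵀ)ᵀ)}
      (∑ i ∈ Finset.univ.filter (fun i : Fin T => R ≤ (i : ℕ)), mu (Zᵀ * Z) i) := by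
  have hA : (Zᵀ * Z).PosSemidef := by simpa using posSemidef_conjTranspose_mul_self Z
  obtain ⟨V, hV, hspec⟩ := exists_orthogonal_diagonalization_mu hA.isHermitian
  have hV' : V * Vᵀ = 1 := mul_eq_one_comm.mp hV
  have htrace (Q : Matrix (Fin T) (Fin T) ℝ) :
      trace (Zᵀ * Z * Q) = ∑ j, mu (Zᵀ * Z) j * (Vᵀ * Q * V) j j := by
    conv_lhs => rw [hspec]
    exact trace_conj_diagonal_mul V Q _
  constructor
  · let f : Matrix (Fin T) (Fin R) ℝ := V.submatrix id (Fin.castLE hRT)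
    have hVf : Vᵀ * f = (1 : Matrix (Fin T) (Fin T) ℝ).submatrix id (Fin.castLE hRT) := by
      rw [← hV]; rfl
    have hff : fᵀ * f = 1 := by
      have : fᵀ * f = (Vᵀ * V).submatrix (Fin.castLE hRT) (Fin.castLE hRT) := rfl
      rw [this, hV, submatrix_one _ (Fin.castLE_injective hRT)]
    have hPt : (f * fᵀ)ᵀ = f * fᵀ := by simp
    have hP : (f * fᵀ) * (f * fᵀ) = f * fᵀ := by
      rw [Matrix.mul_assoc, ← Matrix.mul_assoc fᵀ, hff, Matrix.one_mul]
    obtain ⟨hQt, hQ⟩ := projection_compl hPt hP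
    refine ⟨Z * f, f, ?_⟩
    have hZ : Z - Z * f * fᵀ = Z * (1 - f * fᵀ) := by
      rw [Matrix.mul_sub, Matrix.mul_one, Matrix.mul_assoc]
    rw [hZ, trace_mul_projection_mul_transpose Z hQt hQ, htrace, Finset.sum_filter]
    refine Finset.sum_congr rfl fun j _ => ?_
    have hdiag : (Vᵀ * (1 - f * fᵀ) * V : Matrix (Fin T) (Fin T) ℝ) j j = if R ≤ (j : ℕ) then 1 else 0 := by
      have : Vᵀ * (1 - f * fᵀ) * V = 1 - (Vᵀ * f) * (Vᵀ * f)ᵀ := by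
        rw [Matrix.mul_sub, Matrix.sub_mul, Matrix.mul_one, hV, transpose_mul,
          transpose_transpose]
        simp only [Matrix.mul_assoc]
      rw [this, hVf, Matrix.sub_apply, one_apply_eq, mul_apply]
      simp only [transpose_apply, submatrix_apply, id, one_apply]
      split_ifs with h
      · rw [Finset.sum_eq_zero, sub_zero]
        intro k _
        rw [if_neg, zero_mul]
        rintro rfl
        exact absurd k.isLt (not_lt.mpr h)
      · rw [Finset.sum_eq_single ⟨j, not_le.mp h⟩]
        · simp
        · intro k _ hk
          rw [if_neg, zero_mul]
          rintro rfl
          exact hk rfl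
        · simp
    rw [hdiag]
    split_ifs <;> simp
  · rintro x ⟨l, f, rfl⟩
    obtain ⟨P, hPt, hP, hfP, htr⟩ := exists_column_projection f
    obtain ⟨hQt, hQ⟩ := projection_compl hPt hP
    set B := Z - l * fᵀ with hB
    have hBQ : B * (1 - P) = Z * (1 - P) := by
      rw [hB, Matrix.sub_mul, Matrix.mul_assoc l, hfP, Matrix.mul_zero, sub_zero]
    have hproj : trace (Zᵀ * Z * (1 - P)) ≤ trace (B * Bᵀ) := by
      have h1 := trace_mul_transpose_self_nonneg (B * P)
      rw [trace_mul_projection_mul_transpose B hPt hP] at h1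
      have h2 := trace_mul_projection_mul_transpose B hQt hQ
      rw [hBQ, trace_mul_projection_mul_transpose Z hQt hQ, Matrix.mul_sub (Bᵀ * B),
        Matrix.mul_one, trace_sub, trace_mul_comm Bᵀ B] at h2
      linarith
    refine le_trans ?_ hproj
    have hcompl (j : Fin T) : (Vᵀ * (1 - P) * V) j j = 1 - (Vᵀ * P * V) j j := by
      rw [Matrix.mul_sub, Matrix.sub_mul, Matrix.mul_one, hV, Matrix.sub_apply, one_apply_eq]
    rw [htrace]
    simp only [hcompl]
    refine sum_tail_le_sum_mul_one_sub hRT (mu_antitone _) (mu_nonneg hA)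
      (diag_conj_projection_nonneg V hPt hP) (fun j => ?_) ?_
    · have := diag_conj_projection_nonneg V hQt hQ j
      rw [hcompl] at this
      linarith
    · change trace (Vᵀ * P * V) ≤ R
      rw [trace_mul_comm, ← Matrix.mul_assoc, hV', Matrix.one_mul]
      simpa using htr
end

section
/- Let Z be a real N×T matrix and R a natural number with R ≤ N. Then the infimum over all real N×R matrices λ of Tr(Zᵀ M_λ Z) equals Σ_{i=R+1}^{N} μ_i(ZZᵀ), the sum of the N − R smallest eigenvalues of ZZᵀ; the infimum is attained by taking the columns of λ to be R orthonormal eigenvectors of ZZᵀ corresponding to its R largest eigenvalues. -/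
open Matrix

/-- `IsProjOnto X P` says that `P` is the matrix of the orthogonal projection of `ℝ^N`
onto the column space of `X`: `P` is symmetric, idempotent, fixes the columns of `X`,
and its columns lie in the column space of `X`. (Then `M_X = 1 - P`.) -/
def IsProjOnto {N R : ℕ} (X : Matrix (Fin N) (Fin R) ℝ)
    (P : Matrix (Fin N) (Fin N) ℝ) : Prop :=
  Pᵀ = P ∧ P * P = P ∧ P * X = X ∧ ∃ Y : Matrix (Fin R) (Fin N) ℝ, P = X * Y

/-- The trace of an idempotent matrix is its rank. -/
theorem Matrix.trace_eq_rank_of_isIdempotentElem {n : Type*} [Fintype n] [DecidableEq n]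
    {P : Matrix n n ℝ} (hP : IsIdempotentElem P) : P.trace = P.rank := by
  have h : IsIdempotentElem (Matrix.toLin' P) := by
    rw [IsIdempotentElem, Module.End.mul_eq_comp, ← Matrix.toLin'_mul, hP.eq]
  rw [← Matrix.trace_toLin'_eq, (LinearMap.IsIdempotentElem.isProj_range _ h).trace, Matrix.rank]
  rfl

theorem IsProjOnto.trace_le {N R : ℕ} {X : Matrix (Fin N) (Fin R) ℝ}
    {P : Matrix (Fin N) (Fin N) ℝ} (h : IsProjOnto X P) : P.trace ≤ R := by
  obtain ⟨-, hP, -, Y, rfl⟩ := h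
  rw [Matrix.trace_eq_rank_of_isIdempotentElem hP]
  exact_mod_cast (Matrix.rank_mul_le_left X Y).trans X.rank_le_width

/-- The projection onto the span of orthonormal columns is `X * Xᵀ`. -/
theorem IsProjOnto.eq_mul_transpose {N R : ℕ} {X : Matrix (Fin N) (Fin R) ℝ}
    {P : Matrix (Fin N) (Fin N) ℝ} (h : IsProjOnto X P) (hX : Xᵀ * X = 1) : P = X * Xᵀ := by
  obtain ⟨hsymm, -, hfix, Y, hY⟩ := h
  have h1 : X * Xᵀ * P = X * Xᵀ := by
    simpa [Matrix.transpose_mul, hsymm, Matrix.mul_assoc] using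
      congrArg (fun M => X * Mᵀ) hfix
  rw [← h1]
  conv_rhs => rw [hY, Matrix.mul_assoc, ← Matrix.mul_assoc Xᵀ, hX, Matrix.one_mul]
  exact hY

theorem isProjOnto_mul_transpose {N R : ℕ} {X : Matrix (Fin N) (Fin R) ℝ}
    (hX : Xᵀ * X = 1) : IsProjOnto X (X * Xᵀ) := by
  refine ⟨by simp [Matrix.transpose_mul], ?_, ?_, Xᵀ, rfl⟩
  · rw [Matrix.mul_assoc, ← Matrix.mul_assoc Xᵀ, hX, Matrix.one_mul]
  · rw [Matrix.mul_assoc, hX, Matrix.mul_one]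

/-- Spectral decomposition with the eigenvalues in decreasing order. -/
theorem exists_orthogonal_mul_eq_mul_diagonal_mu {n : ℕ} {A : Matrix (Fin n) (Fin n) ℝ}
    (hA : A.IsHermitian) :
    ∃ U : Matrix (Fin n) (Fin n) ℝ, Uᵀ * U = 1 ∧ U * Uᵀ = 1 ∧
      A * U = U * Matrix.diagonal (mu A) := by
  let σ : Equiv.Perm (Fin n) := Fin.revPerm.trans (Tuple.sort hA.eigenvalues)
  let V : Matrix (Fin n) (Fin n) ℝ := hA.eigenvectorUnitary
  have hV : Vᵀ * V = 1 := by
    simpa [Matrix.star_eq_conjTranspose] using Unitary.coe_star_mul_self hA.eigenvectorUnitary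
  have hU : (V.submatrix id σ)ᵀ * V.submatrix id σ = 1 := by
    rw [Matrix.transpose_submatrix, ← Matrix.submatrix_mul _ _ _ id _ Function.bijective_id, hV,
      Matrix.submatrix_one_equiv]
  refine ⟨V.submatrix id σ, hU, mul_eq_one_comm.mp hU, ?_⟩
  ext i j
  have h := congrFun (hA.mulVec_eigenvectorBasis (σ j)) i
  rw [Matrix.mul_diagonal, mu, dif_pos hA, mul_comm]
  exact h

theorem sum_castLE_add_sum_filter {N R : ℕ} (hRN : R ≤ N) (f : Fin N → ℝ) :
    ∑ j : Fin R, f (Fin.castLE hRN j) +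
      ∑ i ∈ Finset.univ.filter (fun i : Fin N => R ≤ (i : ℕ)), f i = ∑ i, f i := by
  rw [← Finset.sum_filter_not_add_sum_filter Finset.univ (fun i : Fin N => R ≤ (i : ℕ)) f]
  congr 1
  refine (Finset.sum_map Finset.univ (Fin.castLEEmb hRN) f).symm.trans ?_
  congr 1
  ext i
  simp only [Finset.mem_map, Finset.mem_univ, true_and, Finset.mem_filter, not_le]
  exact Set.ext_iff.mp (Fin.range_castLE hRN) i

/-- A weighted sum of a decreasing nonnegative sequence, with weights in `[0, 1]` of total mass
at most `R`, omits at least the sum of the terms of index `≥ R`. -/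
theorem sum_filter_le_sum_one_sub_mul {N R : ℕ} (hRN : R ≤ N) {m q : Fin N → ℝ}
    (hm : Antitone m) (hm0 : ∀ i, 0 ≤ m i) (hq0 : ∀ i, 0 ≤ q i) (hq1 : ∀ i, q i ≤ 1)
    (hq : ∑ i, q i ≤ R) :
    ∑ i ∈ Finset.univ.filter (fun i : Fin N => R ≤ (i : ℕ)), m i ≤ ∑ i, (1 - q i) * m i := by
  obtain ⟨c, hc0, hlt, hge⟩ : ∃ c : ℝ, 0 ≤ c ∧ (∀ i : Fin N, (i : ℕ) < R → c ≤ m i) ∧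
      ∀ i : Fin N, R ≤ (i : ℕ) → m i ≤ c := by
    rcases hRN.lt_or_eq with h | rfl
    · exact ⟨m ⟨R, h⟩, hm0 _, fun i hi => hm (Fin.le_def.mpr hi.le),
        fun i hi => hm (Fin.le_def.mpr hi)⟩
    · exact ⟨0, le_rfl, fun i _ => hm0 i, fun i hi => absurd i.2 hi.not_gt⟩
  have hcard := sum_castLE_add_sum_filter hRN (fun _ => (1 : ℝ))
  have hpt : ∑ i : Fin N, c * ((1 - q i) - if R ≤ (i : ℕ) then 1 else 0) ≤
      ∑ i : Fin N, ((1 - q i) * m i - if R ≤ (i : ℕ) then m i else 0) := by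
    refine Finset.sum_le_sum fun i _ => ?_
    split_ifs with h
    · nlinarith [hge i h, hq0 i]
    · nlinarith [hlt i (not_le.mp h), hq1 i]
  rw [← Finset.mul_sum, Finset.sum_sub_distrib, Finset.sum_sub_distrib, Finset.sum_sub_distrib,
    ← Finset.sum_filter, ← Finset.sum_filter] at hpt
  have hnn : 0 ≤ c * (∑ i : Fin N, (1 : ℝ) - ∑ i, q i -
      ∑ i ∈ Finset.univ.filter (fun i : Fin N => R ≤ (i : ℕ)), (1 : ℝ)) := by
    refine mul_nonneg hc0 ?_
    rw [← hcard]
    simp only [Finset.sum_const, Finset.card_univ, Fintype.card_fin, nsmul_eq_mul, mul_one]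
    linarith
  linarith

/-- The diagonal entries of a symmetric idempotent matrix lie in `[0, 1]`. -/
theorem diag_mem_Icc_of_symm_idempotent {n : Type*} [Fintype n] {Q : Matrix n n ℝ}
    (hs : Qᵀ = Q) (hi : Q * Q = Q) (i : n) : Q i i ∈ Set.Icc (0 : ℝ) 1 := by
  have h : Q i i = ∑ j, Q i j ^ 2 := by
    conv_lhs => rw [← hi, Matrix.mul_apply]
    refine Finset.sum_congr rfl fun j _ => ?_
    rw [sq, ← Matrix.transpose_apply Q i j, hs]
  have hsq : Q i i ^ 2 ≤ Q i i := by
    conv_rhs => rw [h]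
    exact Finset.single_le_sum (f := fun j => Q i j ^ 2) (fun j _ => sq_nonneg _)
      (Finset.mem_univ i)
  exact ⟨(sq_nonneg _).trans hsq, by nlinarith⟩

theorem trace_transpose_mul_one_sub_mul {N T : ℕ} (Z : Matrix (Fin N) (Fin T) ℝ)
    (P : Matrix (Fin N) (Fin N) ℝ) :
    (Zᵀ * (1 - P) * Z).trace = (Z * Zᵀ).trace - (P * (Z * Zᵀ)).trace := by
  rw [Matrix.mul_assoc, Matrix.trace_mul_comm, Matrix.mul_assoc, Matrix.sub_mul, Matrix.one_mul,
    Matrix.trace_sub]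

theorem trace_eq_sum_mu {n : ℕ} {A : Matrix (Fin n) (Fin n) ℝ} (hA : A.IsHermitian) :
    A.trace = ∑ i, mu A i := by
  obtain ⟨U, hU, hU', hAU⟩ := exists_orthogonal_mul_eq_mul_diagonal_mu hA
  calc A.trace = (A * U * Uᵀ).trace := by rw [Matrix.mul_assoc, hU', Matrix.mul_one]
    _ = ∑ i, mu A i := by
      rw [hAU, Matrix.trace_mul_comm, ← Matrix.mul_assoc, hU, Matrix.one_mul,
        Matrix.trace_diagonal]

/-- A projection onto the span of `R` orthonormal leading eigenvectors of `Z * Zᵀ` leaves exactly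
the remaining eigenvalues. -/
theorem IsProjOnto.trace_eq_of_mul_eq {N T R : ℕ} (hRN : R ≤ N) {Z : Matrix (Fin N) (Fin T) ℝ}
    {l : Matrix (Fin N) (Fin R) ℝ} {P : Matrix (Fin N) (Fin N) ℝ} (h : IsProjOnto l P)
    (hl : lᵀ * l = 1)
    (hA : Z * Zᵀ * l = l * Matrix.diagonal (fun j => mu (Z * Zᵀ) (Fin.castLE hRN j))) :
    (Zᵀ * (1 - P) * Z).trace =
      ∑ i ∈ Finset.univ.filter (fun i : Fin N => R ≤ (i : ℕ)), mu (Z * Zᵀ) i := by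
  have hH : (Z * Zᵀ).IsHermitian := by
    simpa using Matrix.isHermitian_mul_conjTranspose_self Z
  rw [trace_transpose_mul_one_sub_mul, trace_eq_sum_mu hH, h.eq_mul_transpose hl,
    Matrix.trace_mul_comm, ← Matrix.mul_assoc, hA, Matrix.trace_mul_comm, ← Matrix.mul_assoc, hl,
    Matrix.one_mul, Matrix.trace_diagonal, ← sum_castLE_add_sum_filter hRN]
  ring

theorem IsProjOnto.sum_mu_le_trace {N T R : ℕ} (hRN : R ≤ N) (Z : Matrix (Fin N) (Fin T) ℝ)
    {l : Matrix (Fin N) (Fin R) ℝ} {P : Matrix (Fin N) (Fin N) ℝ} (h : IsProjOnto l P) :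
    ∑ i ∈ Finset.univ.filter (fun i : Fin N => R ≤ (i : ℕ)), mu (Z * Zᵀ) i ≤
      (Zᵀ * (1 - P) * Z).trace := by
  have hpsd : (Z * Zᵀ).PosSemidef := by
    simpa using Matrix.posSemidef_self_mul_conjTranspose Z
  obtain ⟨U, hU, hU', hAU⟩ := exists_orthogonal_mul_eq_mul_diagonal_mu hpsd.1
  have hs : (Uᵀ * P * U)ᵀ = Uᵀ * P * U := by
    simp [Matrix.transpose_mul, h.1, Matrix.mul_assoc]
  have hi : Uᵀ * P * U * (Uᵀ * P * U) = Uᵀ * P * U := by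
    calc Uᵀ * P * U * (Uᵀ * P * U) = Uᵀ * P * (U * Uᵀ) * P * U := by simp only [Matrix.mul_assoc]
      _ = Uᵀ * P * U := by rw [hU', Matrix.mul_one, Matrix.mul_assoc Uᵀ P P, h.2.1]
  have htr : ∑ i, (Uᵀ * P * U) i i ≤ R := by
    change (Uᵀ * P * U).trace ≤ R
    rw [Matrix.trace_mul_comm, ← Matrix.mul_assoc, hU', Matrix.one_mul]
    exact h.trace_le
  have hPA : (P * (Z * Zᵀ)).trace = ∑ i, (Uᵀ * P * U) i i * mu (Z * Zᵀ) i := by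
    calc (P * (Z * Zᵀ)).trace = (P * (Z * Zᵀ * U) * Uᵀ).trace := by
          rw [Matrix.mul_assoc, Matrix.mul_assoc (Z * Zᵀ), hU', Matrix.mul_one]
      _ = (Uᵀ * P * U * Matrix.diagonal (mu (Z * Zᵀ))).trace := by
          rw [hAU, Matrix.trace_mul_comm]; simp only [Matrix.mul_assoc]
      _ = _ := by simp only [Matrix.trace, Matrix.diag_apply, Matrix.mul_diagonal]
  rw [trace_transpose_mul_one_sub_mul, trace_eq_sum_mu hpsd.1, hPA, ← Finset.sum_sub_distrib]
  refine (sum_filter_le_sum_one_sub_mul hRN (mu_antitone _) (mu_nonneg hpsd)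
    (fun i => (diag_mem_Icc_of_symm_idempotent hs hi i).1)
    (fun i => (diag_mem_Icc_of_symm_idempotent hs hi i).2) htr).trans_eq ?_
  exact Finset.sum_congr rfl fun i _ => by ring

/-- The infimum over all `N×R` matrices `λ` of `Tr(Zᵀ M_λ Z)` equals the sum of the
`N − R` smallest eigenvalues of `ZZᵀ`; moreover it is attained at any `λ` whose columns
are `R` orthonormal eigenvectors of `ZZᵀ` corresponding to its `R` largest eigenvalues. -/
theorem statement2 (N T R : ℕ) (hRN : R ≤ N) (Z : Matrix (Fin N) (Fin T) ℝ) :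
    IsLeast {x : ℝ | ∃ (l : Matrix (Fin N) (Fin R) ℝ) (P : Matrix (Fin N) (Fin N) ℝ),
        IsProjOnto l P ∧ x = Matrix.trace (Zᵀ * (1 - P) * Z)}
      (∑ i ∈ Finset.univ.filter (fun i : Fin N => R ≤ (i : ℕ)), mu (Z * Zᵀ) i) ∧
    ∀ l : Matrix (Fin N) (Fin R) ℝ,
      lᵀ * l = 1 →
      (∀ j : Fin R, (Z * Zᵀ) *ᵥ (fun i => l i j) =
        mu (Z * Zᵀ) (Fin.castLE hRN j) • (fun i => l i j)) →
      ∀ P : Matrix (Fin N) (Fin N) ℝ, IsProjOnto l P →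
        Matrix.trace (Zᵀ * (1 - P) * Z) =
          ∑ i ∈ Finset.univ.filter (fun i : Fin N => R ≤ (i : ℕ)), mu (Z * Zᵀ) i := by
  refine ⟨⟨?_, ?_⟩, ?_⟩
  · have hH : (Z * Zᵀ).IsHermitian := by
      simpa using Matrix.isHermitian_mul_conjTranspose_self Z
    obtain ⟨U, hU, -, hAU⟩ := exists_orthogonal_mul_eq_mul_diagonal_mu hH
    let l : Matrix (Fin N) (Fin R) ℝ := U.submatrix id (Fin.castLE hRN)
    have hl : lᵀ * l = 1 := by
      ext i j
      refine (congrFun₂ hU (Fin.castLE hRN i) (Fin.castLE hRN j)).trans ?_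
      simp [Matrix.one_apply]
    have hP := isProjOnto_mul_transpose hl
    refine ⟨l, l * lᵀ, hP, (hP.trace_eq_of_mul_eq hRN hl ?_).symm⟩
    ext i j
    rw [Matrix.mul_diagonal]
    exact (congrFun₂ hAU i (Fin.castLE hRN j)).trans (Matrix.mul_diagonal ..)
  · rintro _ ⟨l, P, hP, rfl⟩
    exact hP.sum_mu_le_trace hRN Z
  · intro l hl heig P hP
    refine hP.trace_eq_of_mul_eq hRN hl ?_
    ext i j
    rw [Matrix.mul_diagonal, mul_comm]
    exact congrFun (heig j) i
end

section
/- Let W be a real K×K symmetric positive definite matrix and H a real r×K matrix with rank(H) = r ≤ K. Then H W⁻¹ Hᵀ is invertible, and the K×K matrix 𝔚 := W⁻¹ − W⁻¹Hᵀ(H W⁻¹ Hᵀ)⁻¹H W⁻¹ satisfies: (a) H 𝔚 = 0; (b) 𝔚 is positive semidefinite; and (c) rank(𝔚) = K − r. -/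
open Matrix

namespace Matrix

variable {m n R : Type*} [Fintype n] [Field R]

lemma rank_add_le_rank_add_rank [Finite m] (A B : Matrix m n R) : (A + B).rank ≤ A.rank + B.rank := by
  rw [rank, mulVecLin_add]
  exact (Submodule.finrank_mono (LinearMap.range_add_le A.mulVecLin B.mulVecLin)).trans
    (Submodule.finrank_add_le_finrank_add_finrank A.mulVecLin.range B.mulVecLin.range)

lemma vecMul_injective_of_rank_eq_card [Fintype m] {H : Matrix m n R} (hH : H.rank = Fintype.card m) :
    Function.Injective H.vecMul := by
  rw [vecMul_injective_iff, linearIndependent_iff_card_eq_finrank_span, ← hH,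
    rank_eq_finrank_span_row]
  rfl

end Matrix

/-- Let `W` be a real `K×K` symmetric positive definite matrix and `H` a real `r×K`
matrix with `rank H = r ≤ K`.  Then `H W⁻¹ Hᵀ` is invertible, and
`𝔚 := W⁻¹ − W⁻¹Hᵀ(H W⁻¹ Hᵀ)⁻¹H W⁻¹` satisfies `H 𝔚 = 0`, `𝔚` is positive semidefinite,
and `rank 𝔚 = K − r`. -/
theorem statement17 (K r : ℕ) (hrK : r ≤ K)
    (W : Matrix (Fin K) (Fin K) ℝ) (hW : W.PosDef)
    (H : Matrix (Fin r) (Fin K) ℝ) (hH : H.rank = r) :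
    IsUnit (H * W⁻¹ * Hᵀ) ∧
    H * (W⁻¹ - W⁻¹ * Hᵀ * (H * W⁻¹ * Hᵀ)⁻¹ * H * W⁻¹) = 0 ∧
    (W⁻¹ - W⁻¹ * Hᵀ * (H * W⁻¹ * Hᵀ)⁻¹ * H * W⁻¹).PosSemidef ∧
    (W⁻¹ - W⁻¹ * Hᵀ * (H * W⁻¹ * Hᵀ)⁻¹ * H * W⁻¹).rank = K - r := by
  have hS : (H * W⁻¹ * Hᵀ).PosDef := by
    rw [← conjTranspose_eq_transpose_of_trivial]
    exact hW.inv.mul_mul_conjTranspose_same (vecMul_injective_of_rank_eq_card (by simpa using hH))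
  have hWW : W⁻¹ * W = 1 := nonsing_inv_mul _ ((isUnit_iff_isUnit_det _).1 hW.isUnit)
  have hSS : H * W⁻¹ * Hᵀ * (H * W⁻¹ * Hᵀ)⁻¹ = 1 :=
    mul_nonsing_inv _ ((isUnit_iff_isUnit_det _).1 hS.isUnit)
  have hVt : W⁻¹ᵀ = W⁻¹ := by
    simpa [IsHermitian, conjTranspose_eq_transpose_of_trivial] using hW.inv.isHermitian
  have hTt : (H * W⁻¹ * Hᵀ)⁻¹ᵀ = (H * W⁻¹ * Hᵀ)⁻¹ := by
    simpa only [IsHermitian, conjTranspose_eq_transpose_of_trivial] using hS.inv.isHermitian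
  have hVrank : (W⁻¹).rank = K := by
    simpa using rank_of_isUnit _ hW.inv.isUnit
  have hSu := hS.isUnit
  generalize (H * W⁻¹ * Hᵀ)⁻¹ = T at *
  generalize W⁻¹ = V at *
  have hHM : H * (V - V * Hᵀ * T * H * V) = 0 := by
    calc H * (V - V * Hᵀ * T * H * V) = H * V - (H * V * Hᵀ * T) * (H * V) := by
          simp only [Matrix.mul_sub, Matrix.mul_assoc]
      _ = 0 := by rw [hSS, Matrix.one_mul, sub_self]
  refine ⟨hSu, hHM, ?_, ?_⟩
  · have hMt : (V - V * Hᵀ * T * H * V)ᴴ = V - V * Hᵀ * T * H * V := by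
      simp only [conjTranspose_eq_transpose_of_trivial, transpose_sub, transpose_mul,
        transpose_transpose, hVt, hTt, Matrix.mul_assoc]
    have hMWM : (V - V * Hᵀ * T * H * V) * W * (V - V * Hᵀ * T * H * V)ᴴ =
        V - V * Hᵀ * T * H * V := by
      have hMW : (V - V * Hᵀ * T * H * V) * W = 1 - V * Hᵀ * T * H := by
        rw [Matrix.sub_mul, Matrix.mul_assoc _ V W, hWW, Matrix.mul_one]
      rw [hMt, hMW, Matrix.sub_mul, Matrix.one_mul, Matrix.mul_assoc _ H (V - _), hHM,
        Matrix.mul_zero, sub_zero]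
    exact hMWM ▸ hW.posSemidef.mul_mul_conjTranspose_same _
  · have hupper := rank_add_rank_le_card_of_mul_eq_zero hHM
    have hlower := rank_add_le_rank_add_rank (V - V * Hᵀ * T * H * V) (V * Hᵀ * T * H * V)
    have hcorr : (V * Hᵀ * T * H * V).rank ≤ r :=
      (rank_mul_le_left _ _).trans ((rank_mul_le_right _ _).trans hH.le)
    rw [sub_add_cancel, hVrank] at hlower
    rw [hH, Fintype.card_fin] at hupper
    omega
end
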